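/- Consider a rotate-to-root access to element s in tree T with search path P, producing tree T', and list the search path without s in reverse order as a_1,…,a_{|P|−1}. If a_i and a_{i+1} lie on opposite sides of s, then for Z_i = {a_i, a_{i+1}} and every positive weight function w: 2 ≤ Φ_T(Z_i) − Φ_{T'}(Z_i) + log( w(T(a_{i+1})) / w(T(a_i)) ). -/

import Mathlib

namespace Paper

inductive BTree where
  | nil : BTree
  | node : BTree → ℕ → BTree → BTree
deriving DecidableEq

namespace BTree

def keys : BTree → Finset ℕ
  | nil => ∅
  | node l x r => insert x (keys l ∪ keys r)

def root? : BTree → Option ℕ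
  | nil => none
  | node _ x _ => some x

def isBST : BTree → Prop
  | nil => True
  | node l x r => (∀ y ∈ keys l, y < x) ∧ (∀ y ∈ keys r, x < y) ∧ isBST l ∧ isBST r

def subtree? (s : ℕ) : BTree → Option BTree
  | nil => none
  | node l x r => if s = x then some (node l x r) else if s < x then subtree? s l else subtree? s r

/-- The set of keys of the subtree rooted at `s` (∅ if `s` is not in the tree). -/
def subtreeKeys (T : BTree) (s : ℕ) : Finset ℕ := ((subtree? s T).map keys).getD ∅

/-- The search path to `s`, listed from the root downwards. -/
def pathList (s : ℕ) : BTree → List ℕ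
  | nil => []
  | node l x r => if s = x then [x] else if s < x then x :: pathList s l else x :: pathList s r

def pathSet (T : BTree) (s : ℕ) : Finset ℕ := (pathList s T).toFinset

def nodeDepth (s : ℕ) : BTree → ℕ
  | nil => 0
  | node l x r => if s = x then 0 else if s < x then nodeDepth s l + 1 else nodeDepth s r + 1

/-- Number of right-going edges on the path from the root to `s`. -/
def rightDepth (s : ℕ) : BTree → ℕ
  | nil => 0
  | node l x r => if s = x then 0 else if s < x then rightDepth s l else rightDepth s r + 1

/-- Number of left-going edges on the path from the root to `s`. -/
def leftDepth (s : ℕ) : BTree → ℕ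
  | nil => 0
  | node l x r => if s = x then 0 else if s < x then leftDepth s l + 1 else leftDepth s r

def leafCount : BTree → ℕ
  | nil => 0
  | node nil _ nil => 1
  | node l _ r => leafCount l + leafCount r

/-- The wing partition of a BST, each wing listed from its topmost node downwards. -/
def wings : BTree → List (List ℕ)
  | nil => []
  | node l x r =>
    match wings l with
    | [] => [x] :: wings r
    | wl :: rest => (x :: wl) :: (rest ++ wings r)

end BTree

open BTree

/-- The left-leaning path on `[n]`: `n` at the root, `1` at the deepest node. -/
def leftPathTree : ℕ → BTree
  | 0 => BTree.nil
  | n + 1 => BTree.node (leftPathTree n) (n + 1) BTree.nil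

/-- Number of side alternations (w.r.t. `s`) between adjacent elements of a list. -/
def sideAlt (s : ℕ) : List ℕ → ℕ
  | x :: y :: rest => (if (x < s ∧ s < y) ∨ (y < s ∧ s < x) then 1 else 0) + sideAlt s (y :: rest)
  | _ => 0

/-- The set of elements involved in side alternations (w.r.t. `s`) in a list. -/
def zigzagSet (s : ℕ) : List ℕ → Finset ℕ
  | x :: y :: rest =>
    (if (x < s ∧ s < y) ∨ (y < s ∧ s < x) then ({x, y} : Finset ℕ) else ∅) ∪ zigzagSet s (y :: rest)
  | _ => ∅

noncomputable def wsum (w : ℕ → ℝ) (X : Finset ℕ) : ℝ := ∑ b ∈ X, w b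

/-- Partial sum-of-logs potential of the set `X` in tree `T` (binary logarithm). -/
noncomputable def phiOn (w : ℕ → ℝ) (T : BTree) (X : Finset ℕ) : ℝ :=
  ∑ a ∈ X, Real.logb 2 (wsum w (subtreeKeys T a))

noncomputable def phiAll (w : ℕ → ℝ) (T : BTree) : ℝ := phiOn w T (keys T)

/-- A single access of a minimally self-adjusting BST algorithm: the accessed element `s`
becomes the root, the keys are unchanged, and every node off the search path keeps its
subtree; hence the search path is replaced by an after-tree rooted at `s` and the pendent
subtrees are reattached in the unique order-preserving way. -/
structure IsAccess (T : BTree) (s : ℕ) (T' : BTree) : Prop where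
  hT : isBST T
  hT' : isBST T'
  hs : s ∈ keys T
  hkeys : keys T' = keys T
  hroot : root? T' = some s
  hpendent : ∀ a ∈ keys T, a ∉ pathSet T s → subtree? a T' = subtree? a T

/-- The algorithm (viewed as the set of accesses it may perform) satisfies the access lemma
via the sum-of-logs potential. -/
def SatisfiesAL (Alg : BTree → ℕ → BTree → Prop) : Prop :=
  ∃ C : ℝ, 0 ≤ C ∧ ∀ T s T', Alg T s T' → ∀ w : ℕ → ℝ, (∀ i ∈ keys T, 0 < w i) →
    ((pathSet T s).card : ℝ) ≤
      phiAll w T - phiAll w T' + C * (1 + Real.logb 2 (wsum w (keys T) / w s))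

/-- `X` is subtree-disjoint (w.r.t. the tree after the access). -/
def SubtreeDisjoint (T' : BTree) (X : Finset ℕ) : Prop :=
  ∀ a ∈ X, ∀ b ∈ X, a ≠ b → subtreeKeys T' a ∩ subtreeKeys T' b = ∅

/-- `X` is monotone: all elements on one side of `s`, with equal right-depth
(resp. left-depth) in the after-tree.  (For nodes of the search path, depth in the
after-tree coincides with depth in `T'`.) -/
def IsMonotone (s : ℕ) (T' : BTree) (X : Finset ℕ) : Prop :=
  ((∀ x ∈ X, s < x) ∧ ∃ d, ∀ x ∈ X, rightDepth x T' = d) ∨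
  ((∀ x ∈ X, x < s) ∧ ∃ d, ∀ x ∈ X, leftDepth x T' = d)

/-- The after-tree minus its root can be partitioned into (at most) `k` monotone sets. -/
def MonotoneDecomp (T : BTree) (s : ℕ) (T' : BTree) (k : ℕ) : Prop :=
  ∃ M : Fin k → Finset ℕ,
    (∀ i, IsMonotone s T' (M i)) ∧
    (∀ i j, i ≠ j → Disjoint (M i) (M j)) ∧
    Finset.univ.biUnion M = pathSet T s \ {s}

/-- The leaves of the after-tree: path nodes having no path node as proper descendant in `T'`. -/
def afterLeaves (T : BTree) (s : ℕ) (T' : BTree) : Finset ℕ :=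
  (pathSet T s).filter (fun x => subtreeKeys T' x ∩ pathSet T s = {x})

/-- Rotate-to-root: `s` becomes the root and ancestor relations are otherwise preserved,
equivalently `T'(a) = T(a) ∩ (-∞,s)` for path nodes `a < s` and symmetrically for `a > s`. -/
def IsRotateToRoot (T : BTree) (s : ℕ) (T' : BTree) : Prop :=
  subtreeKeys T' s = keys T ∧
  ∀ a ∈ pathSet T s,
    (a < s → subtreeKeys T' a = (subtreeKeys T a).filter (fun b => b < s)) ∧
    (s < a → subtreeKeys T' a = (subtreeKeys T a).filter (fun b => s < b))

def pendTree : Option ℕ → BTree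
  | none => BTree.nil
  | some u => BTree.node BTree.nil u BTree.nil

def buildLeft (l : List (ℕ × Option ℕ)) : BTree :=
  l.foldl (fun t vc => BTree.node (pendTree vc.2) vc.1 t) BTree.nil

def buildRight (l : List (ℕ × Option ℕ)) : BTree :=
  l.foldl (fun t vc => BTree.node t vc.1 (pendTree vc.2)) BTree.nil

/-- Global view of splay: process the reversed search path `v₁, v₂, …` in pairs; if a pair
lies on the same side of `s`, the more ancestral element is removed from its path and
becomes a (pendant) child of the other.  Returns the two spines (elements `< s` and `> s`),
deepest first, each spine node with its optional pendant child. -/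
def splaySpines (s : ℕ) : List ℕ → List (ℕ × Option ℕ) × List (ℕ × Option ℕ)
  | [] => ([], [])
  | [v] => if v < s then ([(v, none)], []) else ([], [(v, none)])
  | v :: u :: rest =>
    let p := splaySpines s rest
    if v < s then
      if u < s then ((v, some u) :: p.1, p.2)
      else ((v, none) :: p.1, (u, none) :: p.2)
    else
      if u < s then ((u, none) :: p.1, (v, none) :: p.2)
      else (p.1, (v, some u) :: p.2)

/-- The after-tree of a splay access, built from the reversed search path without `s`. -/
def splayAfterTree (s : ℕ) (l : List ℕ) : BTree :=
  BTree.node (buildLeft (splaySpines s l).1) s (buildRight (splaySpines s l).2)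

/-- A splay access: a valid access whose after-tree (the restriction of `T'` to the search
path) is the splay after-tree. -/
def IsSplayAccess (T : BTree) (s : ℕ) (T' : BTree) : Prop :=
  IsAccess T s T' ∧
  ∀ x ∈ pathSet T s,
    subtreeKeys T' x ∩ pathSet T s = subtreeKeys (splayAfterTree s (pathList s T).reverse.tail) x

/-- A path-balance access: a valid access whose after-tree is a balanced BST of depth
`⌈log₂ (1 + |P|)⌉` rooted at `s`. -/
def IsPathBalanceAccess (T : BTree) (s : ℕ) (T' : BTree) : Prop :=
  IsAccess T s T' ∧
  ∀ x ∈ pathSet T s, nodeDepth x T' ≤ Nat.clog 2 (1 + (pathSet T s).card)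

def isParent (Q : BTree) (x y : ℕ) : Prop := pathList y Q = pathList x Q ++ [y]

/-- One step of a decomposition: a (descending) path `Pi` of `Q` is rearranged into a tree,
all other nodes keeping their subtrees. -/
def StepRel (Q Q' : BTree) (Pi : Finset ℕ) : Prop :=
  isBST Q' ∧ keys Q' = keys Q ∧
  (∃ l : List ℕ, l ≠ [] ∧ List.Chain' (isParent Q) l ∧ l.toFinset = Pi) ∧
  (∀ a ∈ keys Q, a ∉ Pi → subtree? a Q' = subtree? a Q)

/-- The transformation of the before-path `P0` (as a tree) into the after-tree `A` admits a
local decomposition with window size `wdw`. -/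
def HasLocalDecomp (s : ℕ) (P0 A : BTree) (wdw : ℕ) : Prop :=
  ∃ (k : ℕ) (Q : ℕ → BTree) (Ps : ℕ → Finset ℕ),
    1 ≤ k ∧ Q 0 = P0 ∧ Q k = A ∧
    (∀ i < k, StepRel (Q i) (Q (i + 1)) (Ps i)) ∧
    s ∈ Ps 0 ∧
    (∀ i, i + 1 < k → (Ps (i + 1) \ Ps i).Nonempty) ∧
    (∀ i, i + 1 < k → (Ps (i + 1) ∩ Ps i).Nonempty) ∧
    (∀ i j, i + 1 < j → j < k → Disjoint (Ps i \ Ps (i + 1)) (Ps j)) ∧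
    (∀ i < k, (Ps i).card ≤ wdw)

/-- The search path to `s` in `T`, as a tree (the before-path of the transformation). -/
def pathTree (s : ℕ) : BTree → BTree
  | BTree.nil => BTree.nil
  | BTree.node l x r =>
    if s = x then BTree.node BTree.nil x BTree.nil
    else if s < x then BTree.node (pathTree s l) x BTree.nil
    else BTree.node BTree.nil x (pathTree s r)

/-- `A` is the after-tree of the access `(T, s, T')`: the restriction of `T'` to the search path. -/
def IsAfterTree (T : BTree) (s : ℕ) (T' A : BTree) : Prop :=
  isBST A ∧ keys A = pathSet T s ∧
  ∀ x ∈ pathSet T s, subtreeKeys A x = subtreeKeys T' x ∩ pathSet T s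

/-- The algorithm is local with window size `wdw`. -/
def IsLocal (Alg : BTree → ℕ → BTree → Prop) (wdw : ℕ) : Prop :=
  ∀ T s T', Alg T s T' → ∀ A, IsAfterTree T s T' A → HasLocalDecomp s (pathTree s T) A wdw

open scoped Classical in
noncomputable def stair (n : ℕ) (h : ℕ → ℕ) (s : ℕ) : Finset ℕ :=
  (Finset.Icc 1 n).filter
    (fun b => ∀ b' ∈ Finset.Icc 1 n, ((s < b' ∧ b' < b) ∨ (b < b' ∧ b' < s)) → h b' < h b)

open scoped Classical in
noncomputable def nbhd (n : ℕ) (h : ℕ → ℕ) (a : ℕ) : Finset ℕ :=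
  (Finset.Icc 1 n).filter
    (fun b => ∀ b' ∈ Finset.Icc 1 n, b' ≠ a → min a b ≤ b' → b' ≤ max a b → h b' < h a)

/-- Geometric sum-of-logs partial potential. -/
noncomputable def phiGeo (n : ℕ) (h : ℕ → ℕ) (w : ℕ → ℝ) (X : Finset ℕ) : ℝ :=
  ∑ a ∈ X, Real.logb 2 (wsum w (nbhd n h a))

/-- `l` is (the reversal of) a valid search path to `s`, without `s`, deepest element first. -/
def ValidRevPath (s : ℕ) (l : List ℕ) : Prop :=
  l.Nodup ∧ s ∉ l ∧
  l.Pairwise (fun a b => (a < s → b < s → b < a) ∧ (s < a → s < b → a < b))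

end Paper

open Paper Paper.BTree
namespace Paper.BTree

lemma pathList_subset_keys (s : ℕ) (T : BTree) : ∀ a ∈ pathList s T, a ∈ keys T := by
  induction T with
  | nil => simp [pathList]
  | node l x r ihl ihr =>
    intro a ha
    simp only [pathList] at ha
    simp only [keys, Finset.mem_insert, Finset.mem_union]
    split_ifs at ha <;> grind

lemma subtreeKeys_node_self (l r : BTree) (x : ℕ) :
    subtreeKeys (node l x r) x = keys (node l x r) := by
  simp [subtreeKeys, subtree?]

lemma subtreeKeys_node_of_lt {l r : BTree} {x a : ℕ} (h : a < x) :
    subtreeKeys (node l x r) a = subtreeKeys l a := by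
  simp [subtreeKeys, subtree?, h, h.ne]

lemma subtreeKeys_node_of_gt {l r : BTree} {x a : ℕ} (h : x < a) :
    subtreeKeys (node l x r) a = subtreeKeys r a := by
  simp [subtreeKeys, subtree?, h.not_gt, h.ne']

lemma subtreeKeys_subset_keys (T : BTree) (a : ℕ) : subtreeKeys T a ⊆ keys T := by
  induction T with
  | nil => simp [subtreeKeys, subtree?]
  | node l x r ihl ihr =>
    rcases lt_trichotomy a x with h | rfl | h
    · rw [subtreeKeys_node_of_lt h]
      intro b hb
      simp [keys, ihl hb]
    · rw [subtreeKeys_node_self]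
    · rw [subtreeKeys_node_of_gt h]
      intro b hb
      simp [keys, ihr hb]

lemma mem_subtreeKeys_self {T : BTree} (hT : isBST T) {a : ℕ} (ha : a ∈ keys T) :
    a ∈ subtreeKeys T a := by
  induction T with
  | nil => simp [keys] at ha
  | node l x r ihl ihr =>
    obtain ⟨hl, hr, hbl, hbr⟩ := hT
    simp only [keys, Finset.mem_insert, Finset.mem_union] at ha
    rcases ha with rfl | ha | ha
    · simp [subtreeKeys_node_self, keys]
    · rw [subtreeKeys_node_of_lt (hl a ha)]
      exact ihl hbl ha
    · rw [subtreeKeys_node_of_gt (hr a ha)]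
      exact ihr hbr ha

/-- Subtrees shrink along a search path. -/
lemma pairwise_subtreeKeys_pathList (s : ℕ) {T : BTree} (hT : isBST T) :
    (pathList s T).Pairwise (fun a b => subtreeKeys T b ⊆ subtreeKeys T a) := by
  induction T with
  | nil => simp [pathList]
  | node l x r ihl ihr =>
    obtain ⟨hl, hr, hbl, hbr⟩ := hT
    simp only [pathList]
    split_ifs
    · simp
    · refine List.pairwise_cons.2 ⟨fun a _ => ?_, (ihl hbl).imp_of_mem fun {a b} ha hb hab => ?_⟩
      · rw [subtreeKeys_node_self]
        exact subtreeKeys_subset_keys _ _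
      · rwa [subtreeKeys_node_of_lt (hl _ (pathList_subset_keys _ _ _ ha)),
          subtreeKeys_node_of_lt (hl _ (pathList_subset_keys _ _ _ hb))]
    · refine List.pairwise_cons.2 ⟨fun a _ => ?_, (ihr hbr).imp_of_mem fun {a b} ha hb hab => ?_⟩
      · rw [subtreeKeys_node_self]
        exact subtreeKeys_subset_keys _ _
      · rwa [subtreeKeys_node_of_gt (hr _ (pathList_subset_keys _ _ _ ha)),
          subtreeKeys_node_of_gt (hr _ (pathList_subset_keys _ _ _ hb))]

end Paper.BTree

lemma two_add_logb_add_logb_le {a b c : ℝ} (ha : 0 < a) (hb : 0 < b) (h : a + b ≤ c) :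
    2 + Real.logb 2 a + Real.logb 2 b ≤ 2 * Real.logb 2 c := by
  have h4 : Real.logb 2 4 = 2 := by
    rw [show (4 : ℝ) = 2 ^ (2 : ℕ) by norm_num, Real.logb_pow, Real.logb_self_eq_one (by norm_num)]
    norm_num
  have hle : 4 * a * b ≤ c ^ 2 := by nlinarith [sq_nonneg (a - b)]
  have hlog := Real.logb_le_logb_of_le (b := 2) (by norm_num) (by positivity) hle
  rw [Real.logb_mul (by positivity) hb.ne', Real.logb_mul (by norm_num) ha.ne', Real.logb_pow,
    h4] at hlog
  exact_mod_cast hlog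

/-- **Claim (zig-zag step for rotate-to-root).** For a rotate-to-root access, if `a_i` and
`a_{i+1}` are adjacent on the reversed search path (without `s`) and lie on opposite sides
of `s`, then `2 ≤ Φ_T(Z_i) − Φ_{T'}(Z_i) + log(w(T(a_{i+1})) / w(T(a_i)))`. -/
theorem zigzag_pair_claim (T : BTree) (s : ℕ) (T' : BTree)
    (hacc : IsAccess T s T') (hrot : IsRotateToRoot T s T')
    (i : ℕ) (x y : ℕ)
    (hx : ((pathList s T).reverse.tail)[i]? = some x)
    (hy : ((pathList s T).reverse.tail)[i + 1]? = some y)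
    (hopp : (x < s ∧ s < y) ∨ (y < s ∧ s < x))
    (w : ℕ → ℝ) (hw : ∀ j ∈ keys T, 0 < w j) :
    2 ≤ phiOn w T {x, y} - phiOn w T' {x, y} +
        Real.logb 2 (wsum w (subtreeKeys T y) / wsum w (subtreeKeys T x)) := by
  have memP : ∀ {j a}, ((pathList s T).reverse.tail)[j]? = some a → a ∈ pathList s T := fun h =>
    List.mem_reverse.1 (List.mem_of_mem_tail (List.mem_of_getElem? h))
  have hxP := memP hx
  have hyP := memP hy
  have hsub : subtreeKeys T x ⊆ subtreeKeys T y := by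
    have hp := (List.pairwise_reverse.2 (pairwise_subtreeKeys_pathList s hacc.hT)).tail
    obtain ⟨hi, rfl⟩ := List.getElem?_eq_some_iff.1 hx
    obtain ⟨hj, rfl⟩ := List.getElem?_eq_some_iff.1 hy
    exact List.pairwise_iff_getElem.1 hp i (i + 1) hi hj (Nat.lt_succ_self i)
  have hxT := mem_subtreeKeys_self hacc.hT (pathList_subset_keys _ _ _ hxP)
  have hyT := mem_subtreeKeys_self hacc.hT (pathList_subset_keys _ _ _ hyP)
  have hpos : ∀ X : Finset ℕ, X ⊆ keys T → X.Nonempty → 0 < wsum w X := fun X hX hne =>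
    Finset.sum_pos (fun j hj => hw j (hX hj)) hne
  have hkey : ∀ a, subtreeKeys T a ⊆ keys T := subtreeKeys_subset_keys T
  obtain ⟨hxl, hxr⟩ := hrot.2 x (List.mem_toFinset.2 hxP)
  obtain ⟨hyl, hyr⟩ := hrot.2 y (List.mem_toFinset.2 hyP)
  obtain ⟨hx', hy', hdisj, hmx, hmy⟩ : subtreeKeys T' x ⊆ subtreeKeys T x ∧
      subtreeKeys T' y ⊆ subtreeKeys T y ∧
      Disjoint (subtreeKeys T' x) (subtreeKeys T' y) ∧
      x ∈ subtreeKeys T' x ∧ y ∈ subtreeKeys T' y := by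
    rcases hopp with ⟨h1, h2⟩ | ⟨h1, h2⟩
    · rw [hxl h1, hyr h2]
      refine ⟨Finset.filter_subset _ _, Finset.filter_subset _ _, ?_, by simp [*], by simp [*]⟩
      rw [Finset.disjoint_left]
      grind
    · rw [hxr h2, hyl h1]
      refine ⟨Finset.filter_subset _ _, Finset.filter_subset _ _, ?_, by simp [*], by simp [*]⟩
      rw [Finset.disjoint_left]
      grind
  have hsum : wsum w (subtreeKeys T' x) + wsum w (subtreeKeys T' y) ≤ wsum w (subtreeKeys T y) := by
    unfold wsum
    rw [← Finset.sum_union hdisj]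
    exact Finset.sum_le_sum_of_subset_of_nonneg (Finset.union_subset (hx'.trans hsub) hy')
      fun j hj _ => (hw j (hkey y hj)).le
  have hlog := two_add_logb_add_logb_le (hpos _ (hx'.trans (hkey x)) ⟨x, hmx⟩)
    (hpos _ (hy'.trans (hkey y)) ⟨y, hmy⟩) hsum
  have hne : x ≠ y := by omega
  rw [phiOn, phiOn, Finset.sum_pair hne, Finset.sum_pair hne,
    Real.logb_div (hpos _ (hkey y) ⟨y, hyT⟩).ne' (hpos _ (hkey x) ⟨x, hxT⟩).ne']
  linarith
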